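/- Let φ be an automorphism of the free group F_n on a finite basis A with n ≥ 1. If φ is almost length-increasing, then |φ(a)| = 1 for every basis element a ∈ A. -/

import Mathlib

namespace FreeGroup

variable {α : Type*} [DecidableEq α]

/-- The length of a positive power of `x`, in terms of the cyclic reduction of `x`. -/
theorem norm_pow_succ (x : FreeGroup α) (n : ℕ) :
    (x ^ (n + 1)).norm = 2 * (reduceCyclically.conjugator x.toWord).length +
      (n + 1) * (reduceCyclically x.toWord).length := by
  rw [norm, toWord_pow, reduceCyclically.reduce_flatten_replicate_succ isReduced_toWord]
  simp only [List.length_append, List.length_flatten, List.map_replicate, List.sum_replicate,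
    invRev_length, smul_eq_mul]
  ring

theorem reduceCyclically_toWord_ne_nil {x : FreeGroup α} (hx : x ≠ 1) :
    reduceCyclically x.toWord ≠ [] := by
  intro h
  have key := reduceCyclically.conj_conjugator_reduceCyclically x.toWord
  rw [h, List.append_nil] at key
  apply hx
  rw [← mk_toWord (x := x), ← key, ← mul_mk, ← inv_mk, mul_inv_cancel]

/-- An element of length at least two has all its positive powers longer than the exponent. -/
theorem lt_norm_pow_succ {x : FreeGroup α} (hx : 1 < x.norm) (n : ℕ) :
    n + 1 < (x ^ (n + 1)).norm := by
  have hx1 : x ≠ 1 := by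
    rintro rfl
    simp at hx
  have hc := List.length_pos_of_ne_nil (reduceCyclically_toWord_ne_nil hx1)
  have h0 := norm_pow_succ x 0
  rw [zero_add, pow_one] at h0
  rw [norm_pow_succ]
  nlinarith

theorem finite_setOf_norm_eq_one [Finite α] : {x : FreeGroup α | x.norm = 1}.Finite := by
  refine (Set.finite_range fun p : α × Bool => mk [p]).subset fun x hx => ?_
  obtain ⟨p, hp⟩ := List.length_eq_one_iff.mp hx
  exact ⟨p, by simp only [← hp, mk_toWord]⟩

theorem norm_eq_one_iff {x : FreeGroup α} : x.norm = 1 ↔ ∃ a, x = of a ∨ x = (of a)⁻¹ := by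
  constructor
  · intro hx
    obtain ⟨⟨a, b⟩, hp⟩ := List.length_eq_one_iff.mp hx
    have h : x = mk [(a, b)] := by rw [← hp, mk_toWord]
    refine ⟨a, ?_⟩
    cases b
    · exact Or.inr h
    · exact Or.inl h
  · rintro ⟨a, rfl | rfl⟩ <;> simp

/-- The preimage of a basis element under an almost length-increasing automorphism has
length one. -/
theorem norm_symm_of_eq_one (φ : FreeGroup α ≃* FreeGroup α)
    (hali : {u : FreeGroup α | (φ u).norm < u.norm}.Finite) (a : α) :
    (φ.symm (of a)).norm = 1 := by
  have hpos : (φ.symm (of a)).norm ≠ 0 := by simp [norm_eq_zero]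
  by_contra hne
  have hx : 1 < (φ.symm (of a)).norm := by omega
  have hφ (n : ℕ) : (φ (φ.symm (of a) ^ (n + 1))).norm = n + 1 := by
    rw [map_pow, MulEquiv.apply_symm_apply, norm_of_pow]
  refine Set.infinite_of_injective_forall_mem (f := fun n : ℕ => φ.symm (of a) ^ (n + 1))
    (fun m n h => ?_) (fun n => ?_) hali
  · have := congrArg (fun y => (φ y).norm) h
    simp only [hφ] at this
    omega
  · rw [Set.mem_ofPred_eq, hφ]
    exact lt_norm_pow_succ hx n

end FreeGroup

/-- If an automorphism `φ` of the free group on a finite nonempty set `A` is almost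
length-increasing (only finitely many elements have shorter image), then every basis
element is sent to an element of length 1. -/
theorem auto_almost_length_increasing_perm {A : Type*} [Fintype A] [DecidableEq A]
    [Nonempty A] (φ : FreeGroup A ≃* FreeGroup A)
    (hali : {u : FreeGroup A | (φ u).norm < u.norm}.Finite) :
    ∀ a : A, (φ (FreeGroup.of a)).norm = 1 := by
  intro a
  have hmaps : Set.MapsTo φ.symm {x | x.norm = 1} {x | x.norm = 1} := by
    intro x hx
    obtain ⟨b, rfl | rfl⟩ := FreeGroup.norm_eq_one_iff.mp hx
    · exact FreeGroup.norm_symm_of_eq_one φ hali b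
    · rw [Set.mem_ofPred_eq, map_inv, FreeGroup.norm_inv_eq]
      exact FreeGroup.norm_symm_of_eq_one φ hali b
  obtain ⟨s, hs, hsa⟩ := ((FreeGroup.finite_setOf_norm_eq_one.injOn_iff_bijOn_of_mapsTo hmaps).mp
    φ.symm.injective.injOn).surjOn (FreeGroup.norm_of a)
  rw [← hsa, MulEquiv.apply_symm_apply]
  exact hs
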